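/- Let a be an involutive homeomorphism of a compact Hausdorff totally disconnected space X and let Fix_a = {x ∈ X : a(x) = x}. The group homomorphism E from {f ∈ C(X,ℤ) : f∘a = f} to C(Fix_a, ℤ/2ℤ) sending f to the pointwise mod-2 reduction of the restriction f|_{Fix_a} is surjective, and its kernel is exactly {g + g∘a : g ∈ C(X,ℤ)}. Consequently {f ∈ C(X,ℤ) : f∘a = f}/{g + g∘a : g ∈ C(X,ℤ)} ≅ C(Fix_a, ℤ/2ℤ), which computes H_{2k+1}(ℤ/2, C(X,ℤ)) for every k ≥ 0. -/

import Mathlib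

section GroupHomologyDef

variable (G M : Type*) [Group G] [AddCommGroup M] [DistribMulAction G M]

/-- The differential on inhomogeneous chains computing the homology of the group `G` with
coefficients in the `G`-module `M` (for the left action of `G` on `M`; a right module is
regarded as a left module by acting by inverses, which does not change homology). -/
noncomputable def inhomogeneousChainsD (n : ℕ) :
    ((Fin (n + 1) → G) →₀ M) →+ ((Fin n → G) →₀ M) :=
  Finsupp.liftAddHom fun g =>
    { toFun := fun m =>
        Finsupp.single (fun i => g i.succ) ((g 0)⁻¹ • m) +
          ∑ j : Fin (n + 1),
            (-1 : ℤ) ^ ((j : ℕ) + 1) • Finsupp.single (Fin.contractNth j (· * ·) g) m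
      map_zero' := by simp
      map_add' := fun a b => by
        simp only [smul_add, Finsupp.single_add, Finset.sum_add_distrib]
        abel }

/-- The subgroup of `n`-cycles of the complex of inhomogeneous chains. -/
noncomputable def homologyCycles : ∀ n : ℕ, AddSubgroup ((Fin n → G) →₀ M)
  | 0 => ⊤
  | (m + 1) => (inhomogeneousChainsD G M m).ker

/-- The `n`-th homology group `Hₙ(G, M)` of the group `G` with coefficients in the
`G`-module `M`: the quotient of the `n`-cycles by the `n`-boundaries of the complex of
inhomogeneous chains. -/
noncomputable def GroupHomology (n : ℕ) : Type _ :=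
  homologyCycles G M n ⧸
    ((inhomogeneousChainsD G M n).range.addSubgroupOf (homologyCycles G M n))

noncomputable instance (n : ℕ) : AddCommGroup (GroupHomology G M n) :=
  QuotientAddGroup.Quotient.addCommGroup _

end GroupHomologyDef

section MiddleHomology

variable {A B C A' B' C' : Type*} [AddCommGroup A] [AddCommGroup B] [AddCommGroup C]
  [AddCommGroup A'] [AddCommGroup B'] [AddCommGroup C']

/-- The homology `ker g / im f` of a pair of composable homomorphisms (more precisely, the
quotient of `ker g` by `im f ∩ ker g`). -/
abbrev MiddleHomology (f : A →+ B) (g : B →+ C) : Type _ :=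
  g.ker ⧸ f.range.addSubgroupOf g.ker

/-- An isomorphism of composable pairs induces an isomorphism on homology. -/
noncomputable def MiddleHomology.congr {f : A →+ B} {g : B →+ C} {f' : A' →+ B'} {g' : B' →+ C'}
    (eA : A ≃+ A') (eB : B ≃+ B') (eC : C ≃+ C') (hf : ∀ x, eB (f x) = f' (eA x))
    (hg : ∀ x, eC (g x) = g' (eB x)) : MiddleHomology f g ≃+ MiddleHomology f' g' :=
  have hker : g.ker.map eB.toAddMonoidHom = g'.ker := by
    ext y
    obtain ⟨x, rfl⟩ := eB.surjective y
    simp [AddMonoidHom.mem_ker, ← hg]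
  QuotientAddGroup.congr _ _
    ((eB.addSubgroupMap g.ker).trans (AddEquiv.addSubgroupCongr hker)) (by
      ext ⟨y, hy⟩
      simp only [AddSubgroup.mem_map, AddSubgroup.mem_addSubgroupOf, AddMonoidHom.mem_range]
      constructor
      · rintro ⟨⟨x, hx⟩, ⟨z, rfl⟩, h⟩
        exact ⟨eA z, by rw [← hf]; exact congrArg Subtype.val h⟩
      · rintro ⟨z, hz⟩
        obtain ⟨w, rfl⟩ := eA.surjective z
        rw [← hf] at hz
        change eB (f w) = y at hz
        subst hz
        refine ⟨⟨f w, ?_⟩, ⟨w, rfl⟩, rfl⟩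
        rw [AddMonoidHom.mem_ker] at hy ⊢
        rw [← hg] at hy
        simpa using hy)

/-- The homology of a short complex of modules is the homology of the underlying pair of additive
homomorphisms. -/
noncomputable def CategoryTheory.ShortComplex.homologyAddEquivMiddleHomology {R : Type*} [Ring R]
    (S : CategoryTheory.ShortComplex (ModuleCat R)) :
    S.homology ≃+ MiddleHomology S.f.hom.toAddMonoidHom S.g.hom.toAddMonoidHom :=
  S.moduleCatHomologyIso.toLinearEquiv.toAddEquiv.trans
    (QuotientAddGroup.congr (LinearMap.range S.moduleCatToCycles).toAddSubgroup _
      (AddEquiv.refl (LinearMap.ker S.g.hom)) (by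
        ext ⟨y, hy⟩
        simp only [AddSubgroup.mem_map, AddSubgroup.mem_addSubgroupOf, AddMonoidHom.mem_range]
        constructor
        · rintro ⟨_, ⟨z, rfl⟩, h⟩
          exact ⟨z, congrArg Subtype.val h⟩
        · rintro ⟨z, hz⟩
          exact ⟨_, ⟨z, rfl⟩, Subtype.ext hz⟩))

end MiddleHomology

section CyclicGroup

universe u

variable {G : Type} {M : Type u} [AddCommGroup M]

/-- Raise the universe level of the group on inhomogeneous chains. -/
noncomputable def chainsULift (G : Type) (M : Type u) [AddCommGroup M] (n : ℕ) :
    ((Fin n → G) →₀ M) ≃+ ((Fin n → ULift.{u} G) →₀ M) :=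
  Finsupp.domCongr ((Equiv.refl (Fin n)).arrowCongr Equiv.ulift.symm)

theorem chainsULift_single (n : ℕ) (g : Fin n → G) (m : M) :
    chainsULift G M n (Finsupp.single g m) = Finsupp.single (fun i => ULift.up (g i)) m := by
  simp only [chainsULift, Finsupp.domCongr_apply, Finsupp.equivMapDomain_single]
  rfl

instance ULift.smulCommClass_ulift_int [Group G] [DistribMulAction G M] :
    SMulCommClass (ULift.{u} G) (ULift.{u} ℤ) M where
  smul_comm g n m := smul_comm g.down n.down m

variable (G M) in
/-- A `G`-module as a representation over `ℤ`, with `G` and `ℤ` in the universe of the module. -/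
noncomputable abbrev Rep.ofDistribMulActionULift [Group G] [DistribMulAction G M] :
    Rep (ULift.{u} ℤ) (ULift.{u} G) :=
  Rep.ofDistribMulAction (ULift.{u} ℤ) (ULift.{u} G) M

theorem chainsULift_inhomogeneousChainsD [Group G] [DistribMulAction G M] (n : ℕ)
    (x : (Fin (n + 1) → G) →₀ M) :
    chainsULift G M n (inhomogeneousChainsD G M n x) =
      (groupHomology.inhomogeneousChains.d (Rep.ofDistribMulActionULift G M) n).hom
        (chainsULift G M (n + 1) x) := by
  induction x using Finsupp.induction_linear with
  | zero =>
    simp only [map_zero]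
    exact (map_zero
      (groupHomology.inhomogeneousChains.d (Rep.ofDistribMulActionULift G M) n).hom).symm
  | add x y hx hy =>
    simp only [map_add, hx, hy]
    exact (map_add
      (groupHomology.inhomogeneousChains.d (Rep.ofDistribMulActionULift G M) n).hom _ _).symm
  | single g m =>
    rw [chainsULift_single]
    refine Eq.trans ?_ (groupHomology.inhomogeneousChains.d_single
      (A := Rep.ofDistribMulActionULift G M) n (fun i => ULift.up (g i)) m).symm
    simp only [inhomogeneousChainsD, Finsupp.liftAddHom_apply_single, AddMonoidHom.coe_mk,
      ZeroHom.coe_mk, map_add, map_sum, map_zsmul, chainsULift_single]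
    congr 1
    refine Finset.sum_congr rfl fun j _ => ?_
    have h : (fun i => ULift.up (Fin.contractNth j (· * ·) g i)) =
        Fin.contractNth j (· * ·) (fun i => ULift.up.{u} (g i)) := by
      funext i
      simp only [Fin.contractNth]
      split_ifs <;> rfl
    rw [h]
    rcases Nat.even_or_odd ((j : ℕ) + 1) with hj | hj
    · rw [hj.neg_one_pow, hj.neg_one_pow, one_smul]
      exact (one_smul (ULift.{u} ℤ) (Finsupp.single _ m)).symm
    · rw [hj.neg_one_pow, hj.neg_one_pow, neg_one_smul]
      exact (neg_one_smul (ULift.{u} ℤ) (Finsupp.single _ m)).symm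

/-- The homology of the explicit complex of inhomogeneous chains agrees with `groupHomology`. -/
noncomputable def groupHomologyAddEquiv [Group G] [DistribMulAction G M] (n : ℕ) :
    GroupHomology G M (n + 1) ≃+ groupHomology (Rep.ofDistribMulActionULift G M) (n + 1) :=
  AddEquiv.trans
    (MiddleHomology.congr (chainsULift G M (n + 2)) (chainsULift G M (n + 1)) (chainsULift G M n)
      (fun x => (chainsULift_inhomogeneousChainsD _ x).trans
        (LinearMap.congr_fun (congrArg ModuleCat.Hom.hom
          (groupHomology.inhomogeneousChains.d_def _ _)) _).symm)
      (fun x => (chainsULift_inhomogeneousChainsD _ x).trans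
        (LinearMap.congr_fun (congrArg ModuleCat.Hom.hom
          (groupHomology.inhomogeneousChains.d_def _ _)) _).symm)) <|
  ((CategoryTheory.ShortComplex.homologyAddEquivMiddleHomology _).symm.trans
    ((groupHomology.inhomogeneousChains (Rep.ofDistribMulActionULift G M)).homologyIsoSc'
      (n + 2) (n + 1) n (by simp) (by simp)).symm.toLinearEquiv.toAddEquiv)

/-- The homology of a cyclic group of order two in odd degrees. -/
theorem nonempty_groupHomology_odd_addEquiv [DistribMulAction (Multiplicative (ZMod 2)) M]
    {N D : M →+ M}
    (hN : ∀ m, N m = m + Multiplicative.ofAdd (1 : ZMod 2) • m)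
    (hD : ∀ m, D m = Multiplicative.ofAdd (1 : ZMod 2) • m - m) (k : ℕ) :
    Nonempty (GroupHomology (Multiplicative (ZMod 2)) M (2 * k + 1) ≃+ MiddleHomology N D) := by
  let A := Rep.ofDistribMulActionULift (Multiplicative (ZMod 2)) M
  let g : ULift.{u} (Multiplicative (ZMod 2)) := ULift.up (Multiplicative.ofAdd 1)
  have hg : ∀ x, x ∈ Subgroup.zpowers g := by
    rintro ⟨x⟩
    have hx : x = 1 ∨ x = Multiplicative.ofAdd 1 := by
      revert x
      decide
    rcases hx with rfl | rfl
    · exact one_mem _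
    · exact Subgroup.mem_zpowers g
  refine ⟨(groupHomologyAddEquiv (2 * k)).trans <|
    (Rep.FiniteCyclicGroup.groupHomologyIsoOdd A g hg (2 * k + 1) ⟨k, rfl⟩
      ).toLinearEquiv.toAddEquiv.trans <|
    (CategoryTheory.ShortComplex.homologyAddEquivMiddleHomology _).trans <|
    MiddleHomology.congr (AddEquiv.refl M) (AddEquiv.refl M) (AddEquiv.refl M) ?_ ?_⟩
  · intro m
    rw [hN]
    have huniv : (Finset.univ : Finset (Multiplicative (ZMod 2))) =
        {1, Multiplicative.ofAdd 1} := by decide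
    refine (Representation.norm_ofDistribMulAction_eq
      (k := ULift.{u} ℤ) (G := ULift.{u} (Multiplicative (ZMod 2))) (A := M) m).trans ?_
    rw [← Equiv.ulift.symm.sum_comp, huniv, Finset.sum_pair (by decide)]
    exact congrArg (· + _) (one_smul (Multiplicative (ZMod 2)) (show M from m))
  · intro m
    rw [hD]
    simp only [Rep.sub_hom, Rep.applyAsHom]
    rfl

end CyclicGroup

section Involution

variable {X : Type*} [TopologicalSpace X] {a : X ≃ₜ X}

/-- A compact set on which the involution `a` has no fixed points is covered by a clopen set `D`
and its translate, where `D` is disjoint from its translate. -/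
theorem exists_isClopen_disjoint_preimage_of_involutive [TotallySeparatedSpace X]
    (ha : ∀ x, a (a x) = x) {s : Set X} (hs : IsCompact s) (hfix : ∀ x ∈ s, a x ≠ x) :
    ∃ D : Set X, IsClopen D ∧ Disjoint D (a ⁻¹' D) ∧ s ⊆ D ∪ a ⁻¹' D := by
  refine hs.induction_on (p := fun s => ∃ D : Set X, IsClopen D ∧ Disjoint D (a ⁻¹' D) ∧
    s ⊆ D ∪ a ⁻¹' D) ⟨∅, isClopen_empty, by simp, by simp⟩ ?_ ?_ ?_
  · rintro s t hst ⟨D, hD, hdisj, ht⟩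
    exact ⟨D, hD, hdisj, hst.trans ht⟩
  · rintro s t ⟨D, hD, hDd, hs⟩ ⟨E, hE, hEd, ht⟩
    refine ⟨D ∪ (E \ (D ∪ a ⁻¹' D)),
      hD.union (hE.diff (hD.union (hD.preimage a.continuous))), ?_, ?_⟩
    · rw [Set.disjoint_left] at hDd hEd ⊢
      intro x
      have h₁ := @hDd x
      have h₂ := @hEd x
      simp only [Set.mem_union, Set.mem_sdiff, Set.mem_preimage, ha] at h₁ h₂ ⊢
      tauto
    · rintro x (hx | hx)
      · have := hs hx
        simp only [Set.mem_union, Set.mem_sdiff, Set.mem_preimage, ha] at this ⊢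
        tauto
      · have := ht hx
        simp only [Set.mem_union, Set.mem_sdiff, Set.mem_preimage, ha] at this ⊢
        tauto
  · intro x hx
    obtain ⟨U, hU, hxU, haU⟩ := exists_isClopen_of_totally_separated (hfix x hx).symm
    have hV : IsClopen (U \ a ⁻¹' U) := hU.diff (hU.preimage a.continuous)
    refine ⟨U \ a ⁻¹' U, mem_nhdsWithin_of_mem_nhds (hV.isOpen.mem_nhds ⟨hxU, haU⟩),
      U \ a ⁻¹' U, hV, ?_, Set.subset_union_left⟩
    rw [Set.disjoint_left]
    rintro y ⟨hy, -⟩ ⟨-, hy'⟩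
    exact hy' (by simpa [ha] using hy)

/-- Every `ℤ/2`-valued locally constant function on the fixed points of an involution lifts to an
invariant continuous integer-valued function. -/
theorem exists_invariant_lift_of_involutive [CompactSpace X] [T2Space X]
    [TotallyDisconnectedSpace X] (ha : ∀ x, a (a x) = x)
    (q : LocallyConstant {x : X // a x = x} (ZMod 2)) :
    ∃ f : C(X, ℤ), f.comp (a : C(X, X)) = f ∧
      ∀ x : {x : X // a x = x}, ((f x : ℤ) : ZMod 2) = q x := by
  have hF : IsClosed {x : X | a x = x} := isClosed_eq a.continuous continuous_id
  have hcl (s : Set (ZMod 2)) : IsClosed ((↑) '' (q ⁻¹' s) : Set X) :=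
    hF.isClosedEmbedding_subtypeVal.isClosedMap _ ⟨q.isLocallyConstant sᶜ⟩
  obtain ⟨U, hU, hU₁, hU₀⟩ := exists_clopen_of_closed_subset_open (hcl {1}) (hcl {0}).isOpen_compl
    (by
      rintro _ ⟨x, hx, rfl⟩ ⟨y, hy, hyx⟩
      rw [Subtype.ext hyx] at hy
      simp_all)
  let f : C(X, ℤ) := LocallyConstant.charFn ℤ hU
  refine ⟨f * f.comp (a : C(X, X)), ?_, fun x => ?_⟩
  · ext x
    simp [ha, mul_comm]
  · have hx : f (a x) = f x := by rw [x.2]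
    have hq : q x = 0 ∨ q x = 1 := by
      generalize q x = z
      revert z
      decide
    rcases hq with hq | hq
    · have : (x : X) ∉ U := fun h => hU₀ h ⟨x, hq, rfl⟩
      simp [hx, hq, f, LocallyConstant.coe_charFn, this]
    · have : (x : X) ∈ U := hU₁ ⟨x, hq, rfl⟩
      simp [hx, hq, f, LocallyConstant.coe_charFn, this]

/-- An invariant continuous integer-valued function is a norm if and only if it is even at the
fixed points. -/
theorem even_on_fixedPoints_iff_exists_eq_add_comp [CompactSpace X] [TotallySeparatedSpace X]
    (ha : ∀ x, a (a x) = x) {f : C(X, ℤ)} (hf : f.comp (a : C(X, X)) = f) :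
    (∀ x : X, a x = x → ((f x : ℤ) : ZMod 2) = 0) ↔
      ∃ g : C(X, ℤ), f = g + g.comp (a : C(X, X)) := by
  have hfa (x : X) : f (a x) = f x := DFunLike.congr_fun hf x
  constructor
  · intro h
    have hodd : IsClopen (f ⁻¹' {n | ¬ Even n}) := (isClopen_discrete _).preimage f.continuous
    obtain ⟨D, hD, hdisj, hcover⟩ := exists_isClopen_disjoint_preimage_of_involutive ha
      hodd.isClosed.isCompact (fun x hx hax => hx
        (even_iff_two_dvd.2 ((ZMod.intCast_zmod_eq_zero_iff_dvd _ 2).1 (h x hax))))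
    classical
    let g : C(X, ℤ) := ⟨fun x => if Even (f x) then f x / 2 else if x ∈ D then f x else 0, by
      refine Continuous.if (fun x hx => ?_)
        ((continuous_of_discreteTopology (f := fun n : ℤ => n / 2)).comp f.continuous)
        (Continuous.if (fun x hx => ?_) f.continuous continuous_const)
      · have := ((isClopen_discrete {n : ℤ | Even n}).preimage f.continuous).frontier_eq
        exact (this ▸ hx : x ∈ (∅ : Set X)).elim
      · exact (hD.frontier_eq ▸ hx : x ∈ (∅ : Set X)).elim⟩
    refine ⟨g, ContinuousMap.ext fun x => ?_⟩
    have hx₁ := Set.disjoint_left.1 hdisj 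
    have hx₂ := @hcover x
    simp only [Set.mem_preimage, Set.mem_union, Set.mem_ofPred_eq] at hx₁ hx₂
    by_cases hx : Even (f x)
    · simp [g, hfa, hx]
      grind
    · by_cases hxD : x ∈ D
      · simp [g, hfa, hx, hxD, hx₁ hxD]
      · have := (hx₂ hx).resolve_left hxD
        simp [g, hfa, hx, hxD, this]
  · rintro ⟨g, rfl⟩ x hx
    simp [hx, CharTwo.add_self_eq_zero]

/-- Reduction mod `2` of the restriction to the fixed points of `a`. -/
noncomputable def reduceOnFixedPoints (a : X ≃ₜ X) :
    C(X, ℤ) →+ LocallyConstant {x : X // a x = x} (ZMod 2) where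
  toFun f := ⟨fun x => (f x : ZMod 2), (IsLocallyConstant.iff_continuous _).2 <|
    continuous_of_discreteTopology.comp (f.continuous.comp continuous_subtype_val)⟩
  map_zero' := by ext; simp
  map_add' f g := by ext; simp

end Involution

/-- Let `a` be an involutive homeomorphism of a compact Hausdorff totally disconnected space
`X` and `Fix_a` its fixed point set.  The homomorphism `E` from `{f ∈ C(X, ℤ) : f ∘ a = f}` to
`C(Fix_a, ℤ/2)` given by reducing the restriction to `Fix_a` mod `2` is surjective, with
kernel exactly `{g + g ∘ a : g ∈ C(X, ℤ)}`; consequently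
`{f : f ∘ a = f} / {g + g ∘ a} ≅ C(Fix_a, ℤ/2)`, which computes `H_{2k+1}(ℤ/2, C(X, ℤ))`
for every `k ≥ 0`. -/
theorem odd_homology_of_involution {X : Type*} [TopologicalSpace X] [CompactSpace X]
    [T2Space X] [TotallyDisconnectedSpace X] (a : X ≃ₜ X) (ha : ∀ x, a (a x) = x)
    [DistribMulAction (Multiplicative (ZMod 2)) C(X, ℤ)]
    (hact : ∀ f : C(X, ℤ),
      Multiplicative.ofAdd (1 : ZMod 2) • f = f.comp (a : C(X, X))) :
    (∀ q : LocallyConstant {x : X // a x = x} (ZMod 2),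
      ∃ f : C(X, ℤ), f.comp (a : C(X, X)) = f ∧
        ∀ x : {x : X // a x = x}, ((f x : ℤ) : ZMod 2) = q x) ∧
    (∀ f : C(X, ℤ), f.comp (a : C(X, X)) = f →
      ((∀ x : X, a x = x → ((f x : ℤ) : ZMod 2) = 0) ↔
        ∃ g : C(X, ℤ), f = g + g.comp (a : C(X, X)))) ∧
    (∀ k : ℕ, Nonempty (GroupHomology (Multiplicative (ZMod 2)) C(X, ℤ) (2 * k + 1) ≃+
      LocallyConstant {x : X // a x = x} (ZMod 2))) := by
  refine ⟨exists_invariant_lift_of_involutive ha,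
    fun f hf => even_on_fixedPoints_iff_exists_eq_add_comp ha hf, fun k => ?_⟩
  let σ : C(X, ℤ) →+ C(X, ℤ) :=
    ⟨⟨fun f => f.comp (a : C(X, X)), ContinuousMap.zero_comp _⟩,
      fun f g => ContinuousMap.add_comp f g _⟩
  let N : C(X, ℤ) →+ C(X, ℤ) := AddMonoidHom.id _ + σ
  let D : C(X, ℤ) →+ C(X, ℤ) := σ - AddMonoidHom.id _
  obtain ⟨e⟩ := nonempty_groupHomology_odd_addEquiv (N := N) (D := D)
    (fun f => by rw [hact]; rfl) (fun f => by rw [hact]; rfl) k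
  have hmem (f : C(X, ℤ)) : f ∈ D.ker ↔ f.comp (a : C(X, X)) = f := sub_eq_zero
  let E := (reduceOnFixedPoints a).comp D.ker.subtype
  have hE : Function.Surjective E := fun q => by
    obtain ⟨f, hf, hfq⟩ := exists_invariant_lift_of_involutive ha q
    exact ⟨⟨f, (hmem f).2 hf⟩, LocallyConstant.ext hfq⟩
  have hker : N.range.addSubgroupOf D.ker = E.ker := by
    ext ⟨f, hf⟩
    have h := even_on_fixedPoints_iff_exists_eq_add_comp ha ((hmem f).1 hf)
    rw [AddSubgroup.mem_addSubgroupOf, AddMonoidHom.mem_range, AddMonoidHom.mem_ker,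
      LocallyConstant.ext_iff]
    exact (exists_congr fun g => eq_comm).trans (h.symm.trans (Subtype.forall
      (p := fun x => a x = x) (q := fun x => ((f x : ℤ) : ZMod 2) = 0)).symm)
  exact ⟨e.trans ((QuotientAddGroup.quotientAddEquivOfEq hker).trans
    (QuotientAddGroup.quotientKerEquivOfSurjective E hE))⟩
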